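/- Let w ∈ ℝ^m with w ≠ 0, b ∈ ℝ, x ∈ ℝ^m, p ∈ [1, ∞] and q the Hölder conjugate of p. If δ ∈ ℝ^m satisfies sign(⟨w, x + δ⟩ + b) ≠ sign(⟨w, x⟩ + b), then ‖δ‖_p ≥ |⟨w, x⟩ + b| / ‖w‖_q. -/

import Mathlib

open scoped ENNReal

/-- The `ℓ_p` norm of a vector in `ℝ^m`. -/
noncomputable def lpNorm {m : ℕ} (p : ℝ≥0∞) [Fact (1 ≤ p)] (v : Fin m → ℝ) : ℝ :=
  ‖(WithLp.equiv p (Fin m → ℝ)).symm v‖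

theorem lpNorm_one {m : ℕ} (v : Fin m → ℝ) : lpNorm 1 v = ∑ i, |v i| := by
  simp [lpNorm, PiLp.norm_eq_of_L1]

theorem lpNorm_eq_sum {m : ℕ} {p : ℝ≥0∞} [Fact (1 ≤ p)] (hp : 0 < p.toReal)
    (v : Fin m → ℝ) : lpNorm p v = (∑ i, |v i| ^ p.toReal) ^ (1 / p.toReal) := by
  simp [lpNorm, PiLp.norm_eq_sum hp]

theorem abs_apply_le_lpNorm {m : ℕ} (p : ℝ≥0∞) [Fact (1 ≤ p)] (v : Fin m → ℝ) (i : Fin m) :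
    |v i| ≤ lpNorm p v :=
  PiLp.norm_apply_le ((WithLp.equiv p (Fin m → ℝ)).symm v) i

theorem lpNorm_pos {m : ℕ} (p : ℝ≥0∞) [Fact (1 ≤ p)] {v : Fin m → ℝ} (hv : v ≠ 0) :
    0 < lpNorm p v := by
  obtain ⟨i, hi⟩ := Function.ne_iff.mp hv
  exact (abs_pos.mpr hi).trans_le (abs_apply_le_lpNorm p v i)

theorem abs_sum_mul_le_lpNorm_one_mul_lpNorm {m : ℕ} (p : ℝ≥0∞) [Fact (1 ≤ p)]
    (v u : Fin m → ℝ) : |∑ i, v i * u i| ≤ lpNorm 1 v * lpNorm p u := by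
  rw [lpNorm_one, Finset.sum_mul]
  refine (Finset.abs_sum_le_sum_abs _ _).trans (Finset.sum_le_sum fun i _ => ?_)
  rw [abs_mul]
  exact mul_le_mul_of_nonneg_left (abs_apply_le_lpNorm p u i) (abs_nonneg _)

/-- Hölder's inequality for the pairing of `ℓ_q` and `ℓ_p` on `ℝ^m`, endpoints included. -/
theorem abs_sum_mul_le_lpNorm_mul_lpNorm {m : ℕ} {p q : ℝ≥0∞} [Fact (1 ≤ p)] [Fact (1 ≤ q)]
    (hpq : p⁻¹ + q⁻¹ = 1) (v u : Fin m → ℝ) :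
    |∑ i, v i * u i| ≤ lpNorm q v * lpNorm p u := by
  by_cases hp : p = ∞
  · obtain rfl : q = 1 := by simpa [hp] using hpq
    exact abs_sum_mul_le_lpNorm_one_mul_lpNorm p v u
  by_cases hq : q = ∞
  · obtain rfl : p = 1 := by simpa [hq] using hpq
    simpa only [mul_comm] using abs_sum_mul_le_lpNorm_one_mul_lpNorm q u v
  have : ENNReal.HolderConjugate q p := ⟨by rw [add_comm, hpq, inv_one]⟩
  have h := ENNReal.HolderConjugate.toReal_of_ne_top hq hp
  rw [lpNorm_eq_sum h.pos, lpNorm_eq_sum h.symm.pos]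
  refine (Finset.abs_sum_le_sum_abs _ _).trans ?_
  simpa only [abs_mul, abs_abs] using
    Real.inner_le_Lp_mul_Lq Finset.univ (fun i => |v i|) (fun i => |u i|) h

theorem abs_le_abs_of_sign_add_ne {a c : ℝ} (h : Real.sign (a + c) ≠ Real.sign a) :
    |a| ≤ |c| := by
  contrapose! h
  obtain ⟨h₁, h₂⟩ := abs_lt.mp h
  rcases lt_trichotomy a 0 with ha | rfl | ha
  · rw [abs_of_neg ha] at h₁ h₂
    rw [Real.sign_of_neg ha, Real.sign_of_neg (by linarith)]
  · simp at h₁ h₂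
    linarith
  · rw [abs_of_pos ha] at h₁ h₂
    rw [Real.sign_of_pos ha, Real.sign_of_pos (by linarith)]

/-- If a perturbation `δ` flips the sign of the linear classifier `x ↦ sign(⟨w, x⟩ + b)`
at `x`, then `‖δ‖_p ≥ |⟨w, x⟩ + b| / ‖w‖_q`, where `q` is the Hölder conjugate of `p`. -/
theorem adversarial_perturbation_lower_bound {m : ℕ}
    (w : Fin m → ℝ) (hw : w ≠ 0) (b : ℝ) (x : Fin m → ℝ)
    (p q : ℝ≥0∞) [Fact (1 ≤ p)] [Fact (1 ≤ q)] (hpq : p⁻¹ + q⁻¹ = 1)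
    (δ : Fin m → ℝ)
    (hδ : Real.sign (∑ i, w i * (x i + δ i) + b) ≠ Real.sign (∑ i, w i * x i + b)) :
    |∑ i, w i * x i + b| / lpNorm q w ≤ lpNorm p δ := by
  rw [div_le_iff₀ (lpNorm_pos q hw), mul_comm]
  refine (abs_le_abs_of_sign_add_ne ?_).trans (abs_sum_mul_le_lpNorm_mul_lpNorm hpq w δ)
  convert hδ using 2
  simp only [mul_add, Finset.sum_add_distrib]
  ring
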